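/- arXiv:1505.03420 — 8 statements merged into one kernel-verified Lean document; each statement's English description precedes it below -/
import Mathlib

section
/- Let Ω ⊆ ℝ^d be a bounded open set, D > 0 and H ∈ ℝ constants, K, ρ : Ω → ℝ measurable with K(x) ≤ K_M and ρ(x) ≥ 0 for all x ∈ Ω, and let N : ℝ^d → ℝ be twice differentiable on Ω with N, |∇N|², N·ΔN and N²·(K−ρ) integrable over Ω, normalized so that ∫_Ω N(x)²dx = 1. Assume the integration-by-parts identity ∫_Ω N(x)ΔN(x)dx = −∫_Ω |∇N(x)|²dx (which holds under the homogeneous Neumann boundary condition) and that −D·ΔN(x) = N(x)(K(x) − ρ(x) + H) for every x ∈ Ω. Then H ≥ −K_M. -/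
open MeasureTheory Set

/-- The Laplacian of `f : ℝ^d → ℝ` at `x`: the sum of the pure second partial
derivatives `∂²f/∂xᵢ²(x)`. -/
noncomputable def lapl {d : ℕ} (f : EuclideanSpace ℝ (Fin d) → ℝ)
    (x : EuclideanSpace ℝ (Fin d)) : ℝ :=
  ∑ i : Fin d,
    fderiv ℝ (fun y => fderiv ℝ f y (EuclideanSpace.single i 1)) x (EuclideanSpace.single i 1)

/-- Lemma 3.1(i): the principal eigenvalue `H` of `-D Δ N = N (K - ρ + H)` on a bounded
open set `Ω`, with `L²`-normalized eigenfunction `N` and the Neumann integration-by-parts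
identity `∫ N ΔN = -∫ |∇N|²`, satisfies `H ≥ -K_M` whenever `K ≤ K_M` and `ρ ≥ 0`. -/
theorem stmt_2 {d : ℕ} (Ω : Set (EuclideanSpace ℝ (Fin d)))
    (hΩo : IsOpen Ω) (hΩb : Bornology.IsBounded Ω)
    (D H K_M : ℝ) (hD : 0 < D)
    (K ρ : EuclideanSpace ℝ (Fin d) → ℝ)
    (hKmeas : Measurable K) (hρmeas : Measurable ρ)
    (hK : ∀ x ∈ Ω, K x ≤ K_M) (hρ : ∀ x ∈ Ω, 0 ≤ ρ x)
    (N : EuclideanSpace ℝ (Fin d) → ℝ)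
    (hN : ContDiffOn ℝ 2 N Ω)
    (hint0 : IntegrableOn N Ω)
    (hint1 : IntegrableOn (fun x => (N x) ^ 2) Ω)
    (hint2 : IntegrableOn (fun x => ‖gradient N x‖ ^ 2) Ω)
    (hint3 : IntegrableOn (fun x => N x * lapl N x) Ω)
    (hint4 : IntegrableOn (fun x => (N x) ^ 2 * (K x - ρ x)) Ω)
    (hnorm : ∫ x in Ω, (N x) ^ 2 = 1)
    (hibp : ∫ x in Ω, N x * lapl N x = -∫ x in Ω, ‖gradient N x‖ ^ 2)
    (hPDE : ∀ x ∈ Ω, -D * lapl N x = N x * (K x - ρ x + H)) :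
    -K_M ≤ H := by
  have h1 : ∫ x in Ω, -D * (N x * lapl N x) ≤ ∫ x in Ω, (K_M + H) * (N x) ^ 2 := by
    refine setIntegral_mono_on (hint3.const_mul _) (hint1.const_mul _) hΩo.measurableSet ?_
    intro x hx
    have h2 : -D * (N x * lapl N x) = (K x - ρ x + H) * (N x) ^ 2 := by
      linear_combination (N x) * hPDE x hx
    rw [h2]
    exact mul_le_mul_of_nonneg_right (by linarith [hK x hx, hρ x hx]) (sq_nonneg _)
  rw [integral_const_mul, integral_const_mul, hibp, hnorm] at h1
  have h3 : 0 ≤ ∫ x in Ω, ‖gradient N x‖ ^ 2 := integral_nonneg fun x => sq_nonneg _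
  have h4 := mul_nonneg hD.le h3
  linarith
end

section
/- Let Ω ⊆ ℝ^d be a bounded open set with |Ω| > 0, D > 0 and H ∈ ℝ constants, K, ρ : Ω → ℝ integrable with K(x) ≥ 0 for all x ∈ Ω, and let N : ℝ^d → ℝ be twice differentiable and strictly positive on Ω with ΔN/N integrable over Ω. Assume ∫_Ω ΔN(x)/N(x) dx ≥ 0 (which holds under the homogeneous Neumann boundary condition, since then ∫_Ω ΔN/N = ∫_Ω |∇N|²/N²) and that −D·ΔN(x) = N(x)(K(x) − ρ(x) + H) for every x ∈ Ω. Then |Ω|·H ≤ ∫_Ω (ρ(x) − K(x))dx, and in particular H ≤ (1/|Ω|)∫_Ω ρ(x)dx. -/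
open MeasureTheory Set

/-- Lemma 3.1(ii): for the principal eigenpair `(N, H)` of `-D Δ N = N (K - ρ + H)` on a
bounded open set `Ω` with `|Ω| > 0`, `K ≥ 0`, `N > 0`, and `∫_Ω ΔN/N ≥ 0` (Neumann),
one has `|Ω| · H ≤ ∫_Ω (ρ - K)`, and in particular `H ≤ (1/|Ω|) ∫_Ω ρ`. -/
theorem stmt_3 {d : ℕ} (Ω : Set (EuclideanSpace ℝ (Fin d)))
    (hΩo : IsOpen Ω) (hΩb : Bornology.IsBounded Ω) (hΩpos : 0 < volume Ω)
    (D H : ℝ) (hD : 0 < D)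
    (K ρ : EuclideanSpace ℝ (Fin d) → ℝ)
    (hKint : IntegrableOn K Ω) (hρint : IntegrableOn ρ Ω)
    (hK : ∀ x ∈ Ω, 0 ≤ K x)
    (N : EuclideanSpace ℝ (Fin d) → ℝ)
    (hN : ContDiffOn ℝ 2 N Ω)
    (hNpos : ∀ x ∈ Ω, 0 < N x)
    (hquotint : IntegrableOn (fun x => lapl N x / N x) Ω)
    (hibp : 0 ≤ ∫ x in Ω, lapl N x / N x)
    (hPDE : ∀ x ∈ Ω, -D * lapl N x = N x * (K x - ρ x + H)) :
    (volume Ω).toReal * H ≤ (∫ x in Ω, (ρ x - K x)) ∧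
      H ≤ (volume Ω).toReal⁻¹ * ∫ x in Ω, ρ x := by
  have hfin : volume Ω < ⊤ := hΩb.measure_lt_top
  have hV : 0 < (volume Ω).toReal := ENNReal.toReal_pos hΩpos.ne' hfin.ne
  have hms : MeasurableSet Ω := hΩo.measurableSet
  have e1 : (∫ x in Ω, (ρ x - K x)) - D * (∫ x in Ω, lapl N x / N x)
      = (volume Ω).toReal * H := by
    rw [← integral_const_mul]
    refine (integral_sub (hρint.sub hKint) (hquotint.const_mul D)).symm.trans ?_
    have e2 : ∫ x in Ω, ((ρ x - K x) - D * (lapl N x / N x)) = ∫ x in Ω, H := by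
      apply setIntegral_congr_fun hms
      intro x hx
      have h1 := hPDE x hx
      have h2 := (hNpos x hx).ne'
      have h3 : D * (lapl N x / N x) = -(K x - ρ x + H) := by
        field_simp
        linarith
      simp only [h3]
      ring
    refine Eq.trans e2 ?_
    rw [setIntegral_const, smul_eq_mul]
    rfl
  have hmain : (volume Ω).toReal * H ≤ ∫ x in Ω, (ρ x - K x) := by
    have := mul_nonneg hD.le hibp
    linarith
  refine ⟨hmain, ?_⟩
  have h4 : (∫ x in Ω, (ρ x - K x)) = (∫ x in Ω, ρ x) - ∫ x in Ω, K x :=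
    integral_sub hρint hKint
  have h5 : 0 ≤ ∫ x in Ω, K x := setIntegral_nonneg hms hK
  rw [← div_eq_inv_mul, le_div_iff₀ hV]
  linarith
end

section
/- Let Ω ⊆ ℝ^d be a bounded open set, δ > 0, θ₀ ∈ ℝ, let D, H : (θ₀−δ, θ₀+δ) → ℝ be differentiable at θ₀, let K, ρ : Ω → ℝ be bounded measurable, and let N : (θ₀−δ, θ₀+δ) × Ω → ℝ be such that: (a) for every θ, N(θ,·) is twice differentiable in x on Ω and −D(θ)·Δ_x N(θ,x) = N(θ,x)(K(x) − ρ(x) + H(θ)) for all x ∈ Ω; (b) ∫_Ω N(θ,x)²dx = 1 for every θ; (c) N(·,x) and Δ_x N(·,x) are differentiable in θ at θ₀ with ∂_θ(Δ_x N)(θ₀,x) = Δ_x(∂_θ N)(θ₀,x), and N, ∂_θN, Δ_xN, ∂_θ(Δ_xN) are continuous and uniformly bounded on a neighborhood of {θ₀}×Ω, so that differentiation under the integral sign in θ is justified; (d) the Green identities ∫_Ω N(θ₀,x)·Δ_x(∂_θN)(θ₀,x)dx = ∫_Ω (∂_θN)(θ₀,x)·Δ_x N(θ₀,x)dx and ∫_Ω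 N(θ₀,x)·Δ_x N(θ₀,x)dx = −∫_Ω |∇_x N(θ₀,x)|²dx hold (as they do under the homogeneous Neumann boundary condition). Then H is differentiable at θ₀ with H'(θ₀) = D'(θ₀)·∫_Ω |∇_x N(θ₀,x)|²dx. -/
open MeasureTheory Set

/-- Lemma 3.1 (key computation): for the `L²`-normalized eigenpair family
`θ ↦ (N(θ,·), H(θ))` of `-D(θ) Δ_x N(θ,·) = N(θ,·)(K - ρ + H(θ))` on a bounded open set
`Ω`, with `D`, `H` differentiable at `θ₀`, `∂_θ N` and `∂_θ(Δ_x N) = Δ_x(∂_θ N)` existing,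
with the family continuous and uniformly bounded near `{θ₀} × Ω` (justifying
differentiation under the integral sign), and with the Neumann–Green identities holding,
one has `H'(θ₀) = D'(θ₀) · ∫_Ω |∇_x N(θ₀,x)|² dx`. -/
theorem stmt_4 {d : ℕ} (Ω : Set (EuclideanSpace ℝ (Fin d)))
    (hΩo : IsOpen Ω) (hΩb : Bornology.IsBounded Ω)
    (δ θ₀ : ℝ) (hδ : 0 < δ)
    (D H : ℝ → ℝ) (D' H' : ℝ)
    (hD : HasDerivAt D D' θ₀) (hH : HasDerivAt H H' θ₀)
    (K ρ : EuclideanSpace ℝ (Fin d) → ℝ)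
    (hKmeas : Measurable K) (hρmeas : Measurable ρ)
    (hKρbdd : ∃ M : ℝ, ∀ x ∈ Ω, |K x| ≤ M ∧ |ρ x| ≤ M)
    (N Nθ : ℝ → EuclideanSpace ℝ (Fin d) → ℝ)
    -- (a) the eigenvalue equation for every trait value `θ` near `θ₀`
    (ha1 : ∀ θ ∈ Set.Ioo (θ₀ - δ) (θ₀ + δ), ContDiffOn ℝ 2 (N θ) Ω)
    (ha2 : ∀ θ ∈ Set.Ioo (θ₀ - δ) (θ₀ + δ), ∀ x ∈ Ω,
      -(D θ) * lapl (N θ) x = N θ x * (K x - ρ x + H θ))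
    -- (b) the `L²`-normalization
    (hb : ∀ θ ∈ Set.Ioo (θ₀ - δ) (θ₀ + δ), ∫ x in Ω, (N θ x) ^ 2 = 1)
    -- (c) differentiability in `θ`, with `∂_θ(Δ_x N)(θ₀,·) = Δ_x(∂_θ N)(θ₀,·)`,
    -- and continuity plus uniform boundedness near `{θ₀} × Ω` (so that differentiation
    -- under the integral sign in `θ` is justified)
    (hc1 : ∀ θ ∈ Set.Ioo (θ₀ - δ) (θ₀ + δ), ∀ x ∈ Ω,
      HasDerivAt (fun t => N t x) (Nθ θ x) θ)
    (hc2 : ∀ x ∈ Ω, HasDerivAt (fun t => lapl (N t) x) (lapl (Nθ θ₀) x) θ₀)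
    (hc3 : ∃ M : ℝ, ∀ θ ∈ Set.Ioo (θ₀ - δ) (θ₀ + δ), ∀ x ∈ Ω,
      |N θ x| ≤ M ∧ |Nθ θ x| ≤ M ∧ |lapl (N θ) x| ≤ M ∧ |lapl (Nθ θ) x| ≤ M)
    (hc4 : ContinuousOn (fun p : ℝ × EuclideanSpace ℝ (Fin d) => N p.1 p.2)
      ((Set.Ioo (θ₀ - δ) (θ₀ + δ)) ×ˢ Ω))
    (hc5 : ContinuousOn (fun p : ℝ × EuclideanSpace ℝ (Fin d) => Nθ p.1 p.2)
      ((Set.Ioo (θ₀ - δ) (θ₀ + δ)) ×ˢ Ω))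
    (hc6 : ContinuousOn (fun p : ℝ × EuclideanSpace ℝ (Fin d) => lapl (N p.1) p.2)
      ((Set.Ioo (θ₀ - δ) (θ₀ + δ)) ×ˢ Ω))
    (hc7 : ContinuousOn (fun p : ℝ × EuclideanSpace ℝ (Fin d) => lapl (Nθ p.1) p.2)
      ((Set.Ioo (θ₀ - δ) (θ₀ + δ)) ×ˢ Ω))
    -- (d) the Green identities (Neumann boundary condition)
    (hd1 : ∫ x in Ω, N θ₀ x * lapl (Nθ θ₀) x = ∫ x in Ω, Nθ θ₀ x * lapl (N θ₀) x)
    (hd2 : ∫ x in Ω, N θ₀ x * lapl (N θ₀) x = -∫ x in Ω, ‖gradient (N θ₀) x‖ ^ 2) :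
    H' = D' * ∫ x in Ω, ‖gradient (N θ₀) x‖ ^ 2 := by
  obtain ⟨M, hM⟩ := hc3
  have hθ : θ₀ ∈ Set.Ioo (θ₀ - δ) (θ₀ + δ) := ⟨by linarith, by linarith⟩
  have hnhds : Set.Ioo (θ₀ - δ) (θ₀ + δ) ∈ nhds θ₀ := Ioo_mem_nhds hθ.1 hθ.2
  have hfin : volume Ω ≠ ⊤ := hΩb.measure_lt_top.ne
  have slice : ∀ F : ℝ → EuclideanSpace ℝ (Fin d) → ℝ,
      ContinuousOn (fun p : ℝ × EuclideanSpace ℝ (Fin d) => F p.1 p.2)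
        ((Set.Ioo (θ₀ - δ) (θ₀ + δ)) ×ˢ Ω) → ContinuousOn (F θ₀) Ω := by
    intro F hF
    exact hF.comp (f := fun x => (θ₀, x)) (by fun_prop) (fun x hx => ⟨hθ, hx⟩)
  have cN := slice N hc4
  have cNθ := slice Nθ hc5
  have cL := slice (fun t => lapl (N t)) hc6
  have cLθ := slice (fun t => lapl (Nθ t)) hc7
  have integ : ∀ f g : EuclideanSpace ℝ (Fin d) → ℝ, ContinuousOn f Ω → ContinuousOn g Ω →
      (∀ x ∈ Ω, |f x| ≤ M) → (∀ x ∈ Ω, |g x| ≤ M) →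
      IntegrableOn (fun x => f x * g x) Ω := by
    intro f g hf hg bf bg
    refine IntegrableOn.of_bound hfin.lt_top
      ((hf.mul hg).aestronglyMeasurable hΩo.measurableSet) (M * M) ?_
    refine (ae_restrict_iff' hΩo.measurableSet).2 (Filter.Eventually.of_forall fun x hx => ?_)
    rw [Real.norm_eq_abs, abs_mul]
    exact mul_le_mul (bf x hx) (bg x hx) (abs_nonneg _) ((abs_nonneg _).trans (bf x hx))
  have bN := fun x hx => (hM θ₀ hθ x hx).1
  have bNθ := fun x hx => (hM θ₀ hθ x hx).2.1
  have bL := fun x hx => (hM θ₀ hθ x hx).2.2.1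
  have bLθ := fun x hx => (hM θ₀ hθ x hx).2.2.2
  have i1 := integ _ _ cN cL bN bL
  have i2 := integ _ _ cN cLθ bN bLθ
  have i3 := integ _ _ cNθ cL bNθ bL
  have key : ∀ x ∈ Ω, H' * (N θ₀ x) ^ 2 =
      (-D') * (N θ₀ x * lapl (N θ₀) x) +
      ((-D θ₀) * (N θ₀ x * lapl (Nθ θ₀) x) + D θ₀ * (Nθ θ₀ x * lapl (N θ₀) x)) := by
    intro x hx
    have h1 := hD.neg.mul (hc2 x hx)
    have h2 := (hc1 θ₀ hθ x hx).mul (hH.const_add (K x - ρ x))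
    have h3 := h1.unique (h2.congr_of_eventuallyEq
      (Filter.eventually_of_mem hnhds fun t ht => ha2 t ht x hx))
    have h4 := ha2 θ₀ hθ x hx
    simp only [Pi.neg_apply] at h3
    linear_combination (-N θ₀ x) * h3 + Nθ θ₀ x * h4
  have i23 : IntegrableOn (fun x => (-D θ₀) * (N θ₀ x * lapl (Nθ θ₀) x) +
      D θ₀ * (Nθ θ₀ x * lapl (N θ₀) x)) Ω := (i2.const_mul _).add (i3.const_mul _)
  have hint := setIntegral_congr_fun (μ := volume) hΩo.measurableSet key
  rw [integral_const_mul, hb θ₀ hθ, integral_add (i1.const_mul _)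
    i23, integral_add (i2.const_mul _) (i3.const_mul _),
    integral_const_mul, integral_const_mul, integral_const_mul, hd1, hd2] at hint
  linarith
end

section
/- Let D, H : ℝ → ℝ be continuously differentiable and 1-periodic, and let g : ℝ → (0,∞) be continuous with H'(θ) = g(θ)·D'(θ) for every θ ∈ ℝ. Suppose there exist θ_m < θ_M < θ_m + 1 such that D' ≤ 0 on [θ_M − 1, θ_m] and D' ≥ 0 on [θ_m, θ_M]. Then for every θ ∈ [θ_M − 1, θ_M], H(θ) − H(θ_m) ≥ m·(D(θ) − D(θ_m)) ≥ 0, where m = min_{[θ_M−1, θ_M]} g > 0. In particular θ_m is a global minimizer of H over ℝ, and if θ_m is the unique minimizer of D in the period [θ_M − 1, θ_M), then it is also the unique minimizer of H there. -/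
open Set

theorem aux_min (f : ℝ → ℝ) (hf : Differentiable ℝ f) (a c b : ℝ)
    (hdec : ∀ θ ∈ Set.Icc a c, deriv f θ ≤ 0)
    (hinc : ∀ θ ∈ Set.Icc c b, 0 ≤ deriv f θ) (θ : ℝ) (hθ : θ ∈ Set.Icc a b) : f c ≤ f θ := by
  rcases le_total θ c with h | h
  · have := antitoneOn_of_deriv_nonpos (convex_Icc a c) hf.continuous.continuousOn
      hf.differentiableOn (fun x hx => hdec x (interior_subset hx))
    exact this ⟨hθ.1, h⟩ ⟨hθ.1.trans h, le_rfl⟩ h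
  · have := monotoneOn_of_deriv_nonneg (convex_Icc c b) hf.continuous.continuousOn
      hf.differentiableOn (fun x hx => hinc x (interior_subset hx))
    exact this ⟨le_rfl, h.trans hθ.2⟩ ⟨h, hθ.2⟩ h

/-- Lemma 3.1 (conclusion): if `H' = g · D'` with `g` continuous positive, `D`, `H` are `C¹`
and 1-periodic, and `D' ≤ 0` on `[θ_M - 1, θ_m]`, `D' ≥ 0` on `[θ_m, θ_M]`
(with `θ_m < θ_M < θ_m + 1`), then with `m := min_{[θ_M-1, θ_M]} g > 0` one has
`H(θ) - H(θ_m) ≥ m (D(θ) - D(θ_m)) ≥ 0` on `[θ_M - 1, θ_M]`; in particular `θ_m` is a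
global minimizer of `H`, and if `θ_m` is the unique minimizer of `D` in `[θ_M - 1, θ_M)`
then it is also the unique minimizer of `H` there. -/
theorem stmt_5 (D H g : ℝ → ℝ)
    (hD : ContDiff ℝ 1 D) (hH : ContDiff ℝ 1 H)
    (hDper : Function.Periodic D 1) (hHper : Function.Periodic H 1)
    (hg : Continuous g) (hgpos : ∀ θ, 0 < g θ)
    (hHD : ∀ θ, deriv H θ = g θ * deriv D θ)
    (θm θM : ℝ) (h1 : θm < θM) (h2 : θM < θm + 1)
    (hDdec : ∀ θ ∈ Set.Icc (θM - 1) θm, deriv D θ ≤ 0)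
    (hDinc : ∀ θ ∈ Set.Icc θm θM, 0 ≤ deriv D θ) :
    0 < sInf (g '' Set.Icc (θM - 1) θM) ∧
    (∀ θ ∈ Set.Icc (θM - 1) θM,
      sInf (g '' Set.Icc (θM - 1) θM) * (D θ - D θm) ≤ H θ - H θm ∧
        0 ≤ sInf (g '' Set.Icc (θM - 1) θM) * (D θ - D θm)) ∧
    (∀ θ : ℝ, H θm ≤ H θ) ∧
    ((∀ θ ∈ Set.Ico (θM - 1) θM, θ ≠ θm → D θm < D θ) →
      ∀ θ ∈ Set.Ico (θM - 1) θM, θ ≠ θm → H θm < H θ) := by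
  have hne : (Set.Icc (θM - 1) θM).Nonempty := ⟨θM, by constructor <;> linarith⟩
  have hK : IsCompact (g '' Set.Icc (θM - 1) θM) := isCompact_Icc.image hg
  have hmem := hK.sInf_mem (hne.image g)
  have hle : ∀ θ ∈ Set.Icc (θM - 1) θM, sInf (g '' Set.Icc (θM - 1) θM) ≤ g θ :=
    fun θ hθ => csInf_le hK.bddBelow (Set.mem_image_of_mem g hθ)
  have hpos : 0 < sInf (g '' Set.Icc (θM - 1) θM) := by
    obtain ⟨x, -, hx⟩ := hmem
    rw [← hx]
    exact hgpos x
  generalize sInf (g '' Set.Icc (θM - 1) θM) = m at hle hpos ⊢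
  have dD : Differentiable ℝ D := hD.differentiable (by norm_num)
  have dH : Differentiable ℝ H := hH.differentiable (by norm_num)
  have hDmin := aux_min D dD _ _ _ hDdec hDinc
  have hder : ∀ θ, deriv (fun x => H x - m * D x) θ = (g θ - m) * deriv D θ := by
    intro θ
    have := ((dH θ).hasDerivAt.sub ((dD θ).hasDerivAt.const_mul m)).deriv
    rw [hHD] at this
    rw [sub_mul]
    exact this
  have hF := aux_min (fun x => H x - m * D x) (dH.sub (dD.const_mul m)) (θM - 1) θm θM
    (fun θ hθ => by
      rw [hder]
      exact mul_nonpos_of_nonneg_of_nonpos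
        (sub_nonneg.2 (hle θ ⟨hθ.1, hθ.2.trans h1.le⟩)) (hDdec θ hθ))
    (fun θ hθ => by
      rw [hder]
      exact mul_nonneg
        (sub_nonneg.2 (hle θ ⟨by linarith [hθ.1], hθ.2⟩)) (hDinc θ hθ))
  have key : ∀ θ ∈ Set.Icc (θM - 1) θM, m * (D θ - D θm) ≤ H θ - H θm ∧
      0 ≤ m * (D θ - D θm) := by
    intro θ hθ
    refine ⟨?_, mul_nonneg hpos.le (sub_nonneg.2 (hDmin θ hθ))⟩
    have := hF θ hθ
    linarith
  refine ⟨hpos, key, ?_, ?_⟩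
  · intro θ
    obtain ⟨y, hy, hxy⟩ := hHper.exists_mem_Ico one_pos θ (θM - 1)
    rw [hxy]
    have := key y ⟨hy.1, by linarith [hy.2]⟩
    linarith [this.1, this.2]
  · intro hu θ hθ hn
    have h3 := (key θ ⟨hθ.1, hθ.2.le⟩).1
    have h4 := mul_pos hpos (sub_pos.2 (hu θ hθ hn))
    linarith
end

section
/- Let ε > 0 and C > 0, and let u : [0,1] → ℝ be continuously differentiable with ∫₀¹ exp(u(θ)/ε)dθ ≤ C. Then max_{θ∈[0,1]} u(θ) ≤ ε·ln C + 1 + ∫₀¹ u'(s)² ds. -/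
open MeasureTheory Set intervalIntegral

/-- The pointwise estimate of Lemma 4.1: if `u` is continuously differentiable on `[0,1]`
and `∫₀¹ exp(u(θ)/ε) dθ ≤ C` with `ε > 0`, `C > 0`, then
`max_{[0,1]} u ≤ ε ln C + 1 + ∫₀¹ u'(s)² ds`. -/
theorem stmt_7 (ε C : ℝ) (hε : 0 < ε) (hC : 0 < C)
    (u : ℝ → ℝ) (hu : ContDiffOn ℝ 1 u (Set.Icc 0 1))
    (hint : ∫ θ in (0:ℝ)..1, Real.exp (u θ / ε) ≤ C) :
    ∀ θ ∈ Set.Icc (0:ℝ) 1,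
      u θ ≤ ε * Real.log C + 1 + ∫ s in (0:ℝ)..1, (derivWithin u (Set.Icc 0 1) s) ^ 2 := by
  set g := derivWithin u (Set.Icc (0:ℝ) 1) with hg
  have hgc : ContinuousOn g (Icc 0 1) :=
    hu.continuousOn_derivWithin (uniqueDiffOn_Icc one_pos) le_rfl
  have hGc : ContinuousOn (fun s => 1 + g s ^ 2) (Icc 0 1) := by fun_prop
  have hd : ∀ x ∈ Ioo (0:ℝ) 1, HasDerivAt u (g x) x := by
    intro x hx
    exact ((hu.differentiableOn one_ne_zero) x (Ioo_subset_Icc_self hx)).hasDerivWithinAt.hasDerivAt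
      (Icc_mem_nhds hx.1 hx.2)
  have hI : ∫ s in (0:ℝ)..1, (1 + g s ^ 2) = 1 + ∫ s in (0:ℝ)..1, g s ^ 2 := by
    rw [intervalIntegral.integral_add]
    · simp
    · simp
    · apply ContinuousOn.intervalIntegrable
      rw [uIcc_of_le zero_le_one]
      fun_prop
  have key : ∀ a ∈ Icc (0:ℝ) 1, ∀ b ∈ Icc (0:ℝ) 1, a ≤ b →
      |u b - u a| ≤ 1 + ∫ s in (0:ℝ)..1, g s ^ 2 := by
    intro a ha b hb hab
    have hsub : Icc a b ⊆ Icc 0 1 := Icc_subset_Icc ha.1 hb.2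
    have hgi : IntervalIntegrable g volume a b := by
      apply ContinuousOn.intervalIntegrable
      rw [uIcc_of_le hab]
      exact hgc.mono hsub
    have hGi : IntervalIntegrable (fun s => 1 + g s ^ 2) volume a b := by
      apply ContinuousOn.intervalIntegrable
      rw [uIcc_of_le hab]
      exact hGc.mono hsub
    have h1 : ∫ s in a..b, g s = u b - u a :=
      integral_eq_sub_of_hasDerivAt_of_le hab (hu.continuousOn.mono hsub)
        (fun x hx => hd x ⟨ha.1.trans_lt hx.1, hx.2.trans_le hb.2⟩) hgi
    rw [← h1, ← hI]
    calc |∫ s in a..b, g s| ≤ ∫ s in a..b, |g s| := abs_integral_le_integral_abs hab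
      _ ≤ ∫ s in a..b, (1 + g s ^ 2) := by
        apply integral_mono_on hab hgi.abs hGi
        intro x _
        rw [← sq_abs (g x)]
        nlinarith [sq_nonneg (|g x| - 1)]
      _ ≤ ∫ s in (0:ℝ)..1, (1 + g s ^ 2) := by
        apply integral_mono_interval ha.1 hab hb.2
        · exact Filter.Eventually.of_forall fun x => by
            show (0:ℝ) ≤ 1 + g x ^ 2
            positivity
        · apply ContinuousOn.intervalIntegrable
          rwa [uIcc_of_le zero_le_one]
  intro θ hθ
  set I := ∫ s in (0:ℝ)..1, g s ^ 2 with hIdef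
  have hlow : ∀ t ∈ Icc (0:ℝ) 1, u θ - 1 - I ≤ u t := by
    intro t ht
    rcases le_total t θ with h | h
    · have := (abs_le.1 (key t ht θ hθ h)).2
      linarith
    · have := (abs_le.1 (key θ hθ t ht h)).1
      linarith
  have hexp : Real.exp ((u θ - 1 - I) / ε) ≤ C := by
    refine le_trans ?_ hint
    have h2 : ∫ t in (0:ℝ)..1, Real.exp ((u θ - 1 - I) / ε) ≤
        ∫ t in (0:ℝ)..1, Real.exp (u t / ε) := by
      apply integral_mono_on zero_le_one (by simp)
      · apply ContinuousOn.intervalIntegrable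
        rw [uIcc_of_le zero_le_one]
        have := hu.continuousOn
        fun_prop
      · intro t ht
        have := hlow t ht
        gcongr
    simpa using h2
  have h3 := (Real.le_log_iff_exp_le hC).2 hexp
  rw [div_le_iff₀ hε] at h3
  linarith
end

section
/- Let Ω ⊆ ℝ^d be measurable with |Ω| < ∞, ε > 0, D_m > 0 and C₁ ≥ 0 constants, D : ℝ → ℝ with D(θ) ≥ D_m for all θ, and K, ρ : Ω → ℝ measurable with K ≥ 0 and 0 ≤ ρ ≤ C₁ on Ω. Let u : Ω × ℝ → ℝ be 1-periodic in θ, twice differentiable, with all the integrals below finite, and suppose that for all (x,θ) ∈ Ω × ℝ: −(D(θ)/ε)·Δ_x u − (D(θ)/ε²)·|∇_x u|² − ε·∂²_θ u − (∂_θ u)² = K(x) − ρ(x). Assume furthermore that ∫_Ω Δ_x u(x,θ)dx = 0 for every θ (a consequence of the Neumann boundary condition on ∂Ω) and ∫₀¹ ∂²_θ u(x,θ)dθ = 0 for every x (a consequence of the 1-periodicity in θ). Then (D_m/ε²)·∫_Ω∫₀¹ |∇_x u(x,θ)|² dθdx + ∫_Ω∫₀¹ (∂_θ u(x,θ))² dθdx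 ≤ C₁·|Ω|. -/
open MeasureTheory Set intervalIntegral

/-- The energy estimate of Lemma 4.1: for the Hopf–Cole transform `u` satisfying
`-(D(θ)/ε) Δ_x u - (D(θ)/ε²) |∇_x u|² - ε ∂²_θ u - (∂_θ u)² = K - ρ` on `Ω × ℝ`,
1-periodic in `θ`, with `∫_Ω Δ_x u dx = 0` (Neumann) and `∫₀¹ ∂²_θ u dθ = 0` (periodicity),
`D ≥ D_m > 0`, `K ≥ 0`, `0 ≤ ρ ≤ C₁`, all relevant integrals being finite:
`(D_m/ε²) ∫_Ω ∫₀¹ |∇_x u|² + ∫_Ω ∫₀¹ (∂_θ u)² ≤ C₁ |Ω|`. -/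
theorem stmt_8 {d : ℕ} (Ω : Set (EuclideanSpace ℝ (Fin d)))
    (hΩmeas : MeasurableSet Ω) (hΩfin : volume Ω < ⊤)
    (ε D_m C₁ : ℝ) (hε : 0 < ε) (hDm : 0 < D_m) (hC₁ : 0 ≤ C₁)
    (D : ℝ → ℝ) (hD : ∀ θ, D_m ≤ D θ)
    (K ρ : EuclideanSpace ℝ (Fin d) → ℝ)
    (hKmeas : Measurable K) (hρmeas : Measurable ρ)
    (hK : ∀ x ∈ Ω, 0 ≤ K x) (hρ : ∀ x ∈ Ω, 0 ≤ ρ x ∧ ρ x ≤ C₁)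
    (u : EuclideanSpace ℝ (Fin d) → ℝ → ℝ)
    (hper : ∀ x, Function.Periodic (u x) 1)
    (hsmooth : ContDiffOn ℝ 2 (fun p : EuclideanSpace ℝ (Fin d) × ℝ => u p.1 p.2)
      (Ω ×ˢ Set.univ))
    (hPDE : ∀ x ∈ Ω, ∀ θ : ℝ,
      -(D θ / ε) * lapl (fun y => u y θ) x
        - (D θ / ε ^ 2) * ‖gradient (fun y => u y θ) x‖ ^ 2
        - ε * deriv (deriv (u x)) θ - (deriv (u x) θ) ^ 2 = K x - ρ x)
    -- consequence of the Neumann boundary condition on `∂Ω`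
    (hNeumann : ∀ θ : ℝ, ∫ x in Ω, lapl (fun y => u y θ) x = 0)
    -- consequence of the 1-periodicity in `θ`
    (hperiodic : ∀ x ∈ Ω, ∫ θ in (0:ℝ)..1, deriv (deriv (u x)) θ = 0)
    -- finiteness of all the integrals involved
    (hi1 : IntegrableOn
      (fun x => ∫ θ in (0:ℝ)..1, ‖gradient (fun y => u y θ) x‖ ^ 2) Ω)
    (hi2 : IntegrableOn (fun x => ∫ θ in (0:ℝ)..1, (deriv (u x) θ) ^ 2) Ω)
    (hi3 : ∀ x ∈ Ω, IntervalIntegrable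
      (fun θ => (D θ / ε ^ 2) * ‖gradient (fun y => u y θ) x‖ ^ 2) volume 0 1)
    (hi4 : ∀ x ∈ Ω, IntervalIntegrable (fun θ => (deriv (u x) θ) ^ 2) volume 0 1)
    (hi5 : ∀ x ∈ Ω, IntervalIntegrable
      (fun θ => (D θ / ε) * lapl (fun y => u y θ) x) volume 0 1)
    (hi6 : ∀ x ∈ Ω, IntervalIntegrable (fun θ => deriv (deriv (u x)) θ) volume 0 1)
    (hi7 : IntegrableOn
      (fun x => ∫ θ in (0:ℝ)..1, (D θ / ε) * lapl (fun y => u y θ) x) Ω)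
    (hi8 : IntegrableOn
      (fun p : EuclideanSpace ℝ (Fin d) × ℝ => (D p.2 / ε) * lapl (fun y => u y p.2) p.1)
      (Ω ×ˢ Set.Ioc (0:ℝ) 1)) :
    (D_m / ε ^ 2) *
        (∫ x in Ω, ∫ θ in (0:ℝ)..1, ‖gradient (fun y => u y θ) x‖ ^ 2) +
        (∫ x in Ω, ∫ θ in (0:ℝ)..1, (deriv (u x) θ) ^ 2) ≤
      C₁ * (volume Ω).toReal := by
  have hL : ∫ x in Ω, ∫ θ in (0:ℝ)..1, (D θ / ε) * lapl (fun y => u y θ) x = 0 := by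
    have h8 : Integrable (Function.uncurry
        (fun (x : EuclideanSpace ℝ (Fin d)) (θ : ℝ) => (D θ / ε) * lapl (fun y => u y θ) x))
        ((volume.restrict Ω).prod (volume.restrict (Set.Ioc (0:ℝ) 1))) := by
      rw [Measure.prod_restrict]
      exact hi8
    have hsw := integral_integral_swap h8
    simp only [intervalIntegral.integral_of_le (zero_le_one : (0:ℝ) ≤ 1)]
    rw [hsw]
    simp [MeasureTheory.integral_const_mul, hNeumann]
  have hpt : ∀ x ∈ Ω, (D_m / ε ^ 2) * (∫ θ in (0:ℝ)..1, ‖gradient (fun y => u y θ) x‖ ^ 2) +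
      (∫ θ in (0:ℝ)..1, (deriv (u x) θ) ^ 2) ≤
      C₁ - ∫ θ in (0:ℝ)..1, (D θ / ε) * lapl (fun y => u y θ) x := by
    intro x hx
    have hg : (D_m / ε ^ 2) * (∫ θ in (0:ℝ)..1, ‖gradient (fun y => u y θ) x‖ ^ 2) ≤
        ∫ θ in (0:ℝ)..1, (D θ / ε ^ 2) * ‖gradient (fun y => u y θ) x‖ ^ 2 := by
      rw [← intervalIntegral.integral_const_mul]
      simp only [intervalIntegral.integral_of_le (zero_le_one : (0:ℝ) ≤ 1)]
      apply integral_mono_of_nonneg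
      · exact Filter.Eventually.of_forall fun θ => by positivity
      · exact (hi3 x hx).1
      · refine Filter.Eventually.of_forall fun θ => ?_
        have := hD θ
        dsimp only
        gcongr
    have hsum : (∫ θ in (0:ℝ)..1, (deriv (u x) θ) ^ 2) =
        (ρ x - K x) - (∫ θ in (0:ℝ)..1, (D θ / ε) * lapl (fun y => u y θ) x)
        - (∫ θ in (0:ℝ)..1, (D θ / ε ^ 2) * ‖gradient (fun y => u y θ) x‖ ^ 2) := by
      have e : ∀ θ : ℝ, (deriv (u x) θ) ^ 2 = (((ρ x - K x) - (D θ / ε) * lapl (fun y => u y θ) x)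
          - (D θ / ε ^ 2) * ‖gradient (fun y => u y θ) x‖ ^ 2) - ε * deriv (deriv (u x)) θ := by
        intro θ
        have := hPDE x hx θ
        linarith
      have hc : IntervalIntegrable (fun _ : ℝ => ρ x - K x) volume 0 1 :=
        intervalIntegrable_const
      rw [intervalIntegral.integral_congr (fun θ _ => e θ),
        intervalIntegral.integral_sub ((hc.sub (hi5 x hx)).sub (hi3 x hx))
          ((hi6 x hx).const_mul ε),
        intervalIntegral.integral_sub (hc.sub (hi5 x hx)) (hi3 x hx),
        intervalIntegral.integral_sub hc (hi5 x hx),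
        intervalIntegral.integral_const_mul, hperiodic x hx]
      simp
    have h1 := hK x hx
    have h2 := (hρ x hx).2
    linarith
  have hcΩ : IntegrableOn (fun _ : EuclideanSpace ℝ (Fin d) => C₁) Ω :=
    integrableOn_const hΩfin.ne
  have hm := setIntegral_mono_on ((hi1.const_mul (D_m / ε ^ 2)).add hi2) (hcΩ.sub hi7) hΩmeas hpt
  simp only [Pi.add_apply, Pi.sub_apply] at hm
  rw [integral_add (hi1.const_mul (D_m / ε ^ 2)) hi2, integral_sub hcΩ hi7, hL,
    MeasureTheory.integral_const_mul, setIntegral_const] at hm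
  simp only [smul_eq_mul, sub_zero, Measure.real] at hm
  linarith
end

section
/- Let θ_m ∈ (0,1) and let u : [0,1] → ℝ be continuous with u(θ) < u(θ_m) for every θ ∈ [0,1] with θ ≠ θ_m. For ε ∈ (0,1), let u_ε : [0,1] → ℝ be continuous functions converging to u uniformly on [0,1] as ε → 0⁺. Then for every continuous φ : [0,1] → ℝ, lim_{ε→0⁺} (∫₀¹ φ(θ)·exp(u_ε(θ)/ε)dθ) / (∫₀¹ exp(u_ε(θ)/ε)dθ) = φ(θ_m). -/
open MeasureTheory Set Filter Topology

/-- The Laplace-method concentration behind Theorem 1.1: if `u_ε → u` uniformly on `[0,1]`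
as `ε → 0⁺`, where `u` is continuous and attains its strict maximum over `[0,1]` only at
`θ_m ∈ (0,1)`, then for every continuous `φ`,
`(∫₀¹ φ e^{u_ε/ε}) / (∫₀¹ e^{u_ε/ε}) → φ(θ_m)`. -/
theorem stmt_10 (θm : ℝ) (hθm : θm ∈ Set.Ioo (0:ℝ) 1)
    (u : ℝ → ℝ) (hu : ContinuousOn u (Set.Icc 0 1))
    (humax : ∀ θ ∈ Set.Icc (0:ℝ) 1, θ ≠ θm → u θ < u θm)
    (U : ℝ → ℝ → ℝ)
    (hUcont : ∀ ε ∈ Set.Ioo (0:ℝ) 1, ContinuousOn (U ε) (Set.Icc 0 1))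
    (hUconv : TendstoUniformlyOn U u (𝓝[>] (0:ℝ)) (Set.Icc 0 1)) :
    ∀ φ : ℝ → ℝ, ContinuousOn φ (Set.Icc 0 1) →
      Tendsto (fun ε =>
          (∫ θ in (0:ℝ)..1, φ θ * Real.exp (U ε θ / ε)) /
            (∫ θ in (0:ℝ)..1, Real.exp (U ε θ / ε)))
        (𝓝[>] (0:ℝ)) (𝓝 (φ θm)) := by
  intro φ hφ
  have hθ : θm ∈ Set.Icc (0:ℝ) 1 := Ioo_subset_Icc_self hθm
  have hsmall : ∀ᶠ ε in 𝓝[>] (0:ℝ), ε ∈ Set.Ioo (0:ℝ) 1 := Ioo_mem_nhdsGT one_pos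
  have hcont : ∀ ε ∈ Set.Ioo (0:ℝ) 1,
      ContinuousOn (fun θ => Real.exp (U ε θ / ε)) (Set.Icc 0 1) := fun ε hε =>
    Real.continuous_exp.comp_continuousOn ((hUcont ε hε).div_const ε)
  have hint : ∀ ε ∈ Set.Ioo (0:ℝ) 1,
      IntegrableOn (fun θ => Real.exp (U ε θ / ε)) (Set.Icc 0 1) := fun ε hε =>
    (hcont ε hε).integrableOn_compact isCompact_Icc
  -- lower bound on the mass
  have hlow : ∀ η > 0, ∃ δ > 0, ∀ᶠ ε in 𝓝[>] (0:ℝ),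
      δ * Real.exp ((u θm - 2 * η) / ε) ≤ ∫ θ in Set.Icc (0:ℝ) 1, Real.exp (U ε θ / ε) := by
    intro η hη
    obtain ⟨r, hr, hr'⟩ := Metric.continuousOn_iff.1 hu θm hθ η hη
    have hδ : 0 < min (r / 2) (1 - θm) := lt_min (by linarith) (by linarith [hθm.2])
    refine ⟨min (r / 2) (1 - θm), hδ, ?_⟩
    set δ := min (r / 2) (1 - θm) with hδd
    have h1 : δ ≤ r / 2 := min_le_left _ _
    have h2 : δ ≤ 1 - θm := min_le_right _ _
    have hsub : Set.Icc θm (θm + δ) ⊆ Set.Icc (0:ℝ) 1 :=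
      Set.Icc_subset_Icc hθ.1 (by linarith)
    filter_upwards [hsmall, Metric.tendstoUniformlyOn_iff.1 hUconv η hη] with ε hε hU
    calc δ * Real.exp ((u θm - 2 * η) / ε)
        = ∫ θ in Set.Icc θm (θm + δ), Real.exp ((u θm - 2 * η) / ε) := by
          rw [setIntegral_const]
          simp [Real.volume_real_Icc_of_le, hδ.le]
      _ ≤ ∫ θ in Set.Icc θm (θm + δ), Real.exp (U ε θ / ε) := by
          refine setIntegral_mono_on (by simp) ((hint ε hε).mono_set hsub)
            measurableSet_Icc ?_
          intro θ h
          have a := hr' θ (hsub h) (by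
            rw [Real.dist_eq, abs_of_nonneg (by linarith [h.1])]; linarith [h.2])
          have b := hU θ (hsub h)
          rw [Real.dist_eq, abs_lt] at a b
          have := hε.1
          gcongr
          linarith
      _ ≤ _ := setIntegral_mono_set (hint ε hε)
          (Eventually.of_forall fun _ => (Real.exp_pos _).le) hsub.eventuallyLE
  have hpos : ∀ᶠ ε in 𝓝[>] (0:ℝ), 0 < ∫ θ in Set.Icc (0:ℝ) 1, Real.exp (U ε θ / ε) := by
    obtain ⟨δ, hδ, h⟩ := hlow 1 one_pos
    filter_upwards [h] with ε h
    exact lt_of_lt_of_le (by positivity) h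
  have key := tendsto_setIntegral_peak_smul_of_integrableOn_of_tendsto
    (μ := volume) (l := 𝓝[>] (0:ℝ)) (s := Set.Icc (0:ℝ) 1) (t := Set.Icc (0:ℝ) 1)
    (x₀ := θm) (g := φ) (a := φ θm)
    (φ := fun ε θ => Real.exp (U ε θ / ε) / ∫ θ in Set.Icc (0:ℝ) 1, Real.exp (U ε θ / ε))
    measurableSet_Icc measurableSet_Icc subset_rfl self_mem_nhdsWithin (by simp)
    (by
      filter_upwards [hpos] with ε h x _
      positivity)
    (by
      intro v hv hxv
      have hK : IsCompact (Set.Icc (0:ℝ) 1 \ v) := isCompact_Icc.diff hv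
      obtain ⟨η, hη, hle⟩ : ∃ η > 0, ∀ θ ∈ Set.Icc (0:ℝ) 1 \ v, u θ ≤ u θm - 5 * η := by
        rcases (Set.Icc (0:ℝ) 1 \ v).eq_empty_or_nonempty with he | hne
        · exact ⟨1, one_pos, by simp [he]⟩
        · obtain ⟨x, hx, hmax⟩ := hK.exists_isMaxOn hne (hu.mono diff_subset)
          have := humax x hx.1 (fun h => hx.2 (h ▸ hxv))
          refine ⟨(u θm - u x) / 5, by linarith, fun θ h => ?_⟩
          have : u θ ≤ u x := hmax h
          linarith
      obtain ⟨δ, hδ, hl⟩ := hlow η hη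
      have hlim : Tendsto (fun ε : ℝ => δ⁻¹ * Real.exp (-(2 * η * ε⁻¹))) (𝓝[>] 0) (𝓝 0) := by
        have := (Real.tendsto_exp_neg_atTop_nhds_zero.comp
          (tendsto_inv_nhdsGT_zero.const_mul_atTop (show 0 < 2 * η by linarith))).const_mul δ⁻¹
        simpa using this
      rw [Metric.tendstoUniformlyOn_iff]
      intro c hc
      filter_upwards [hsmall, hl, hpos, Metric.tendstoUniformlyOn_iff.1 hUconv η hη,
        hlim.eventually_lt_const hc] with ε hε hl hp hU hlt θ hθK
      have b := hU θ hθK.1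
      have a := hle θ hθK
      rw [Real.dist_eq, abs_lt] at b
      have he := hε.1
      rw [Pi.zero_apply, dist_comm, Real.dist_eq, sub_zero, abs_of_nonneg (by positivity)]
      refine lt_of_le_of_lt ?_ hlt
      rw [div_le_iff₀ hp]
      calc Real.exp (U ε θ / ε) ≤ Real.exp ((u θm - 4 * η) / ε) := by
            gcongr
            linarith
        _ = δ⁻¹ * Real.exp (-(2 * η * ε⁻¹)) * (δ * Real.exp ((u θm - 2 * η) / ε)) := by
            have : (u θm - 4 * η) / ε = -(2 * η * ε⁻¹) + (u θm - 2 * η) / ε := by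
              field_simp; ring
            rw [this, Real.exp_add]
            field_simp
        _ ≤ _ := by gcongr)
    (by
      refine tendsto_const_nhds.congr' ?_
      filter_upwards [hpos] with ε h
      rw [integral_div, div_self h.ne'])
    (by
      filter_upwards [hsmall] with ε hε
      exact ((hcont ε hε).div_const _).aestronglyMeasurable measurableSet_Icc)
    (hφ.integrableOn_compact isCompact_Icc) (hφ θm hθ)
  refine key.congr fun ε => ?_
  rw [intervalIntegral.integral_of_le zero_le_one, intervalIntegral.integral_of_le zero_le_one,
    ← integral_Icc_eq_integral_Ioc, ← integral_Icc_eq_integral_Ioc, ← integral_div]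
  congr 1
  ext θ
  rw [smul_eq_mul]
  ring
end

section
/- Let Ω ⊆ ℝ^d be measurable with 0 < |Ω| < ∞, let ε > 0, C > 0, C' ≥ 0, and let u : Ω × [0,1] → ℝ be measurable, continuously differentiable in θ for each x, with (x,θ) ↦ ∂_θu(x,θ) measurable. Assume ∫₀¹ exp(u(x,θ)/ε)dθ ≤ C for every x ∈ Ω and ∫_Ω∫₀¹ (∂_θ u(x,θ))² dθdx ≤ C'. Then ∫_Ω max_{θ∈[0,1]} u(x,θ) dx ≤ |Ω|·(ε·ln C + 1) + C'. -/
open MeasureTheory Set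

lemma ptwise_aux (v : ℝ → ℝ) (ε C : ℝ) (hε : 0 < ε)
    (hs : ContDiffOn ℝ 1 v (Set.Icc 0 1))
    (hexp : ∫ θ in (0:ℝ)..1, Real.exp (v θ / ε) ≤ C) :
    sSup (v '' Set.Icc (0:ℝ) 1) ≤
      (ε * Real.log C + 1) + ∫ θ in (0:ℝ)..1, (derivWithin v (Set.Icc 0 1) θ) ^ 2 := by
  have hc : ContinuousOn v (Set.Icc 0 1) := hs.continuousOn
  have hg : ContinuousOn (derivWithin v (Set.Icc 0 1)) (Set.Icc 0 1) :=
    hs.continuousOn_derivWithin (uniqueDiffOn_Icc zero_lt_one) le_rfl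
  have hne : (Set.Icc (0:ℝ) 1).Nonempty := ⟨0, by simp⟩
  obtain ⟨a, ha, hmin⟩ := isCompact_Icc.exists_isMinOn hne hc
  have h1 : v a ≤ ε * Real.log C := by
    have hle : Real.exp (v a / ε) ≤ C := by
      refine le_trans ?_ hexp
      have hm : ∫ θ in (0:ℝ)..1, Real.exp (v a / ε) ≤ ∫ θ in (0:ℝ)..1, Real.exp (v θ / ε) := by
        apply intervalIntegral.integral_mono_on zero_le_one
        · simp
        · apply ContinuousOn.intervalIntegrable
          rw [Set.uIcc_of_le zero_le_one]
          exact Real.continuous_exp.comp_continuousOn (hc.div_const ε)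
        · intro x hx
          have := hmin hx
          simp only [Set.mem_setOf_eq] at this
          gcongr
      simpa using hm
    have := (Real.le_log_iff_exp_le (lt_of_lt_of_le (Real.exp_pos _) hle)).2 hle
    rw [div_le_iff₀ hε] at this
    linarith
  apply csSup_le (hne.image v)
  rintro _ ⟨b, hb, rfl⟩
  have hsub : Set.uIcc a b ⊆ Set.Icc 0 1 := Set.uIcc_subset_Icc ha hb
  have hftc : ∫ θ in a..b, derivWithin v (Set.Icc 0 1) θ = v b - v a := by
    apply intervalIntegral.integral_eq_sub_of_hasDeriv_right (hc.mono hsub)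
    · intro x hx
      have hx0 : 0 < x := lt_of_le_of_lt (le_min ha.1 hb.1) hx.1
      have hx1 : x < 1 := lt_of_lt_of_le hx.2 (max_le ha.2 hb.2)
      have hd := (hs.differentiableOn one_ne_zero x ⟨hx0.le, hx1.le⟩).hasDerivWithinAt
      exact (hd.hasDerivAt (Icc_mem_nhds hx0 hx1)).hasDerivWithinAt
    · exact (hg.mono hsub).intervalIntegrable
  have hsq : IntervalIntegrable (fun θ => (derivWithin v (Set.Icc 0 1) θ) ^ 2) volume 0 1 := by
    apply ContinuousOn.intervalIntegrable
    rw [Set.uIcc_of_le zero_le_one]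
    exact hg.pow 2
  have hab : IntervalIntegrable (fun θ => ‖derivWithin v (Set.Icc 0 1) θ‖) volume 0 1 := by
    apply ContinuousOn.intervalIntegrable
    rw [Set.uIcc_of_le zero_le_one]
    exact hg.norm
  have h2 : v b - v a ≤ ∫ θ in (0:ℝ)..1, ‖derivWithin v (Set.Icc 0 1) θ‖ := by
    rw [← hftc]
    refine (le_abs_self _).trans ?_
    rw [← Real.norm_eq_abs]
    refine intervalIntegral.norm_integral_le_integral_norm_uIoc.trans ?_
    rw [intervalIntegral.integral_of_le zero_le_one]
    apply setIntegral_mono_set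
    · exact (intervalIntegrable_iff_integrableOn_Ioc_of_le zero_le_one).1 hab
    · exact Filter.Eventually.of_forall fun x => norm_nonneg _
    · exact (Set.Ioc_subset_Ioc (le_min ha.1 hb.1) (max_le ha.2 hb.2)).eventuallyLE
  have h3 : ∫ θ in (0:ℝ)..1, ‖derivWithin v (Set.Icc 0 1) θ‖ ≤
      ∫ θ in (0:ℝ)..1, (1 + (derivWithin v (Set.Icc 0 1) θ) ^ 2) := by
    apply intervalIntegral.integral_mono_on zero_le_one hab
    · exact (intervalIntegrable_const).add hsq
    · intro x _
      rw [Real.norm_eq_abs]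
      nlinarith [sq_abs (derivWithin v (Set.Icc 0 1) x),
        sq_nonneg (|derivWithin v (Set.Icc 0 1) x| - 1), sq_nonneg (derivWithin v (Set.Icc 0 1) x)]
  rw [intervalIntegral.integral_add intervalIntegrable_const hsq] at h3
  simp only [intervalIntegral.integral_const, sub_zero, smul_eq_mul, mul_one] at h3
  linarith

/-- The integrated form of Lemma 4.1: if `∫₀¹ exp(u(x,θ)/ε) dθ ≤ C` for every `x ∈ Ω` and
`∫_Ω ∫₀¹ (∂_θ u)² dθ dx ≤ C'`, with `u` measurable and continuously differentiable in `θ`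
(all integrals being finite), then `∫_Ω max_{θ∈[0,1]} u(x,θ) dx ≤ |Ω| (ε ln C + 1) + C'`. -/
theorem stmt_14 {d : ℕ} (Ω : Set (EuclideanSpace ℝ (Fin d)))
    (hΩmeas : MeasurableSet Ω) (hΩpos : 0 < volume Ω) (hΩfin : volume Ω < ⊤)
    (ε C C' : ℝ) (hε : 0 < ε) (hC : 0 < C) (hC' : 0 ≤ C')
    (u : EuclideanSpace ℝ (Fin d) → ℝ → ℝ)
    (hmeas : Measurable (fun p : EuclideanSpace ℝ (Fin d) × ℝ => u p.1 p.2))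
    (hsmooth : ∀ x ∈ Ω, ContDiffOn ℝ 1 (u x) (Set.Icc 0 1))
    (hdmeas : Measurable
      (fun p : EuclideanSpace ℝ (Fin d) × ℝ => derivWithin (u p.1) (Set.Icc 0 1) p.2))
    (hexp : ∀ x ∈ Ω, ∫ θ in (0:ℝ)..1, Real.exp (u x θ / ε) ≤ C)
    (henergy : ∫ x in Ω, ∫ θ in (0:ℝ)..1, (derivWithin (u x) (Set.Icc 0 1) θ) ^ 2 ≤ C')
    -- finiteness of the integrals involved
    (hienergy : IntegrableOn
      (fun x => ∫ θ in (0:ℝ)..1, (derivWithin (u x) (Set.Icc 0 1) θ) ^ 2) Ω)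
    (himax : IntegrableOn (fun x => sSup (u x '' Set.Icc (0:ℝ) 1)) Ω) :
    ∫ x in Ω, sSup (u x '' Set.Icc (0:ℝ) 1) ≤
      (volume Ω).toReal * (ε * Real.log C + 1) + C' := by
  have hconst : IntegrableOn (fun _ : EuclideanSpace ℝ (Fin d) => ε * Real.log C + 1) Ω :=
    integrableOn_const hΩfin.ne
  have h := setIntegral_mono_on himax (hconst.add hienergy) hΩmeas
    (fun x hx => ptwise_aux (u x) ε C hε (hsmooth x hx) (hexp x hx))
  have h' := integral_add hconst hienergy
  simp only [Pi.add_apply] at h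
  rw [h', setIntegral_const, smul_eq_mul, measureReal_def] at h
  linarith
end
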